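/- arXiv:1001.5220 — 4 statements merged into one kernel-verified Lean document; each statement's English description precedes it below -/
import Mathlib

section
/- Let A be an integral domain, ⋆ a star operation on A, and a a nonzero element of A. Assume that every proper ⋆-finite ⋆-ideal of A containing a is contained in a proper ⋆-finite ⋆-ideal of A satisfying property (⋆-c.a.). Then every maximal element of the poset (Σ^⋆_a, ⊆) is a maximal element of the poset ((Σ')^⋆_a, ⊆). -/
open scoped nonZeroDivisors

/-- A star operation on an integral domain `A` with quotient field `K`: a map on
(nonzero) fractional ideals satisfying `A^⋆ = A`, `(xI)^⋆ = x·I^⋆`, `I ⊆ I^⋆`,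
monotonicity and idempotency. -/
structure StarOperation (A : Type*) [CommRing A] [IsDomain A]
    (K : Type*) [Field K] [Algebra A K] [IsFractionRing A K] where
  star : FractionalIdeal A⁰ K → FractionalIdeal A⁰ K
  star_one : star 1 = 1
  star_smul : ∀ (x : K), x ≠ 0 → ∀ I : FractionalIdeal A⁰ K, I ≠ 0 →
    star (FractionalIdeal.spanSingleton A⁰ x * I) = FractionalIdeal.spanSingleton A⁰ x * star I
  le_star : ∀ I : FractionalIdeal A⁰ K, I ≠ 0 → I ≤ star I
  mono : ∀ I J : FractionalIdeal A⁰ K, I ≠ 0 → I ≤ J → star I ≤ star J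
  star_idem : ∀ I : FractionalIdeal A⁰ K, I ≠ 0 → star (star I) = star I

variable {A : Type*} [CommRing A] [IsDomain A]
  {K : Type*} [Field K] [Algebra A K] [IsFractionRing A K]

/-- `⋆` is of finite type: `I^⋆` is the union of the `J^⋆` over the finitely
generated (nonzero) fractional ideals `J ⊆ I`. -/
def StarOperation.IsFiniteType (s : StarOperation A K) : Prop :=
  ∀ I : FractionalIdeal A⁰ K, I ≠ 0 → ∀ x : K, x ∈ s.star I →
    ∃ J : FractionalIdeal A⁰ K, J ≠ 0 ∧ J ≤ I ∧ (J : Submodule A K).FG ∧ x ∈ s.star J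

/-- A (nonzero, integral) ideal `I` is a `⋆`-ideal if `I^⋆ = I`. -/
def IsStarIdeal (s : StarOperation A K) (I : Ideal A) : Prop :=
  I ≠ 0 ∧ s.star ↑I = (I : FractionalIdeal A⁰ K)

/-- A (nonzero, integral) ideal `I` is `⋆`-finite if `J^⋆ = I^⋆` for some finitely
generated (nonzero) ideal `J`. -/
def IsStarFinite (s : StarOperation A K) (I : Ideal A) : Prop :=
  I ≠ 0 ∧ ∃ J : Ideal A, J ≠ 0 ∧ J.FG ∧ s.star ↑J = s.star (I : FractionalIdeal A⁰ K)

/-- An ideal of `A` is `⋆`-maximal if it is maximal among proper `⋆`-ideals. -/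
def IsStarMaximal (s : StarOperation A K) (M : Ideal A) : Prop :=
  M ≠ ⊤ ∧ IsStarIdeal s M ∧ ∀ J : Ideal A, J ≠ ⊤ → IsStarIdeal s J → M ≤ J → J = M

/-- Property (⋆-c.a.): for every pair of proper ⋆-finite ⋆-ideals `𝔞₁, 𝔞₂` containing
`𝔞`, the ideal `(𝔞₁ + 𝔞₂)^⋆` is proper. -/
def StarCA (s : StarOperation A K) (𝔞 : Ideal A) : Prop :=
  ∀ 𝔞₁ 𝔞₂ : Ideal A, 𝔞 ≤ 𝔞₁ → 𝔞 ≤ 𝔞₂ →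
    𝔞₁ ≠ ⊤ → IsStarIdeal s 𝔞₁ → IsStarFinite s 𝔞₁ →
    𝔞₂ ≠ ⊤ → IsStarIdeal s 𝔞₂ → IsStarFinite s 𝔞₂ →
    s.star ↑(𝔞₁ + 𝔞₂) ≠ 1

/-- `ℱ` is a ⋆-comaximal collection over `a`: `a` lies in every member and
`(𝔞₁ + 𝔞₂)^⋆ = A` for all distinct members. -/
def IsStarComaximalOver (s : StarOperation A K) (a : A) (F : Set (Ideal A)) : Prop :=
  (∀ I ∈ F, a ∈ I) ∧ ∀ I ∈ F, ∀ J ∈ F, I ≠ J → s.star ↑(I + J) = 1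

/-- `(Σ')^⋆_a`: the ⋆-comaximal collections over `a` of proper ⋆-finite ⋆-ideals. -/
def SigmaP (s : StarOperation A K) (a : A) : Set (Set (Ideal A)) :=
  {F | IsStarComaximalOver s a F ∧ ∀ I ∈ F, I ≠ ⊤ ∧ IsStarIdeal s I ∧ IsStarFinite s I}

/-- `Σ^⋆_a`: members of `(Σ')^⋆_a` all of whose ideals satisfy (⋆-c.a.). -/
def SigmaCA (s : StarOperation A K) (a : A) : Set (Set (Ideal A)) :=
  {F | F ∈ SigmaP s a ∧ ∀ I ∈ F, StarCA s I}

/-- Let `A` be an integral domain, `⋆` a star operation on `A`, and `a ≠ 0`. If every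
proper ⋆-finite ⋆-ideal of `A` containing `a` is contained in a proper ⋆-finite ⋆-ideal
satisfying (⋆-c.a.), then every maximal element of `(Σ^⋆_a, ⊆)` is a maximal element of
`((Σ')^⋆_a, ⊆)`. -/
theorem maximal_in_sigmaCA_is_maximal_in_sigmaP
    (s : StarOperation A K) (a : A) (ha : a ≠ 0)
    (h : ∀ 𝔞 : Ideal A, a ∈ 𝔞 → 𝔞 ≠ ⊤ → IsStarIdeal s 𝔞 → IsStarFinite s 𝔞 →
      ∃ 𝔟 : Ideal A, 𝔞 ≤ 𝔟 ∧ 𝔟 ≠ ⊤ ∧ IsStarIdeal s 𝔟 ∧ IsStarFinite s 𝔟 ∧ StarCA s 𝔟) :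
    ∀ F ∈ SigmaCA s a, (∀ G ∈ SigmaCA s a, F ⊆ G → G = F) →
      ∀ G ∈ SigmaP s a, F ⊆ G → G = F := by
  intro F hF hmax G hG hFG
  have key : ∀ I I' J : Ideal A, I ≠ 0 → I ≤ I' →
      s.star ((I + J : Ideal A) : FractionalIdeal A⁰ K) = 1 →
      s.star ((I' + J : Ideal A) : FractionalIdeal A⁰ K) = 1 := by
    intro I I' J hI hle h1
    have hne : ∀ L : Ideal A, I ≤ L → (L : FractionalIdeal A⁰ K) ≠ 0 := by
      intro L hL h0
      rw [FractionalIdeal.coeIdeal_eq_zero] at h0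
      subst h0
      exact hI (le_bot_iff.mp hL)
    apply le_antisymm
    · rw [← s.star_one]
      exact s.mono _ _ (hne _ (hle.trans le_sup_left)) FractionalIdeal.coeIdeal_le_one
    · rw [← h1]
      exact s.mono _ _ (hne _ le_sup_left)
        ((FractionalIdeal.coeIdeal_le_coeIdeal K).mpr (sup_le_sup_right hle J))
  refine Set.Subset.antisymm ?_ hFG
  intro I hI
  by_contra hIF
  obtain ⟨⟨hGa, hGc⟩, hGp⟩ := hG
  obtain ⟨⟨⟨hFa, hFc⟩, hFp⟩, hFca⟩ := hF
  obtain ⟨hIt, hIs, hIf⟩ := hGp I hI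
  obtain ⟨b, hIb, hbt, hbs, hbf, hbca⟩ := h I (hGa I hI) hIt hIs hIf
  have hbF : ∀ J ∈ F, s.star ((b + J : Ideal A) : FractionalIdeal A⁰ K) = 1 := by
    intro J hJ
    refine key I b J hIs.1 hIb (hGc I hI J (hFG hJ) ?_)
    rintro rfl
    exact hIF hJ
  have hins : insert b F ∈ SigmaCA s a := by
    refine ⟨⟨⟨?_, ?_⟩, ?_⟩, ?_⟩
    · rintro L (rfl | hL)
      · exact hIb (hGa I hI)
      · exact hFa L hL
    · rintro L (rfl | hL) M (rfl | hM) hLM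
      · exact absurd rfl hLM
      · exact hbF M hM
      · rw [add_comm]
        exact hbF L hL
      · exact hFc L hL M hM hLM
    · rintro L (rfl | hL)
      · exact ⟨hbt, hbs, hbf⟩
      · exact hFp L hL
    · rintro L (rfl | hL)
      · exact hbca
      · exact hFca L hL
  have hb : b ∈ F := by
    rw [← hmax _ hins (Set.subset_insert b F)]
    exact Set.mem_insert b F
  have h1 := hbF b hb
  have hbb : b + b = b := sup_idem b
  rw [hbb, hbs.2, FractionalIdeal.coeIdeal_eq_one] at h1
  exact hbt (h1.trans Ideal.one_eq_top)
end

section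
/- Let A be an integral domain, ⋆ a star operation of finite type on A, a a nonzero element of A, and ℱ a collection of ideals of A each containing a. Then the set 𝔞 := {x ∈ A : x·∏ℱ' ⊆ aA for some finite subcollection ℱ' ⊆ ℱ} is a ⋆-ideal of A; moreover, for any x₁, …, xₙ ∈ 𝔞 one has (x₁, …, xₙ)^⋆ ⊆ 𝔞. -/
open scoped nonZeroDivisors

variable {A : Type*} [CommRing A] [IsDomain A]
  {K : Type*} [Field K] [Algebra A K] [IsFractionRing A K]

/-- The set `𝔞 = {x ∈ A : x·∏ℱ' ⊆ aA for some finite subcollection ℱ' ⊆ ℱ}`. -/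
def prodSet {A : Type*} [CommRing A] (F : Set (Ideal A)) (a : A) : Set A :=
  {x : A | ∃ G : Finset (Ideal A), ↑G ⊆ F ∧
    Ideal.span {x} * (G.prod id) ≤ Ideal.span {a}}

/-- The ideal of `y` with `y P ⊆ aA`. -/
def auxC {A : Type*} [CommRing A] (a : A) (P : Ideal A) : Ideal A where
  carrier := {y | ∀ p ∈ P, y * p ∈ Ideal.span {a}}
  zero_mem' := by intro p _; simp
  add_mem' := by
    intro x y hx hy p hp
    rw [add_mul]
    exact Ideal.add_mem _ (hx p hp) (hy p hp)
  smul_mem' := by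
    intro c x hx p hp
    rw [smul_eq_mul, mul_assoc]
    exact Ideal.mul_mem_left _ _ (hx p hp)

lemma mem_auxC {A : Type*} [CommRing A] (a : A) (P : Ideal A) (y : A) :
    y ∈ auxC a P ↔ ∀ p ∈ P, y * p ∈ Ideal.span {a} := Iff.rfl

lemma auxC_anti {A : Type*} [CommRing A] (a : A) {P Q : Ideal A} (h : P ≤ Q) :
    auxC a Q ≤ auxC a P := fun _ hy p hp => hy p (h hp)

lemma auxC_iff {A : Type*} [CommRing A] (a : A) (P : Ideal A) (y : A) :
    y ∈ auxC a P ↔ Ideal.span {y} * P ≤ Ideal.span {a} := by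
  rw [mem_auxC, Ideal.span_singleton_mul_le_iff]

lemma prod_anti {A : Type*} [CommRing A] {G H : Finset (Ideal A)} (h : G ⊆ H) :
    H.prod id ≤ G.prod id := by
  classical
  rw [← Finset.prod_sdiff h]
  exact Ideal.mul_le_right (I := (H \ G).prod id) (J := G.prod id)

lemma star_auxC (s : StarOperation A K) (a : A) (ha : a ≠ 0) (P : Ideal A) :
    s.star (auxC a P : FractionalIdeal A⁰ K) ≤ (auxC a P : FractionalIdeal A⁰ K) := by
  have haC : a ∈ auxC a P := fun p _ =>
    Ideal.mul_mem_right p (Ideal.span {a}) (Ideal.mem_span_singleton_self a)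
  have hC0 : (auxC a P : FractionalIdeal A⁰ K) ≠ 0 := by
    rw [FractionalIdeal.coeIdeal_ne_zero]
    intro h
    rw [h] at haC
    exact ha (by simpa using haC)
  have haK : algebraMap A K a ≠ 0 := by
    simpa using ha
  intro x hx
  have h1 := s.mono _ 1 hC0 FractionalIdeal.coeIdeal_le_one hx
  rw [s.star_one, FractionalIdeal.mem_one_iff] at h1
  obtain ⟨y, rfl⟩ := h1
  rw [FractionalIdeal.mem_coeIdeal]
  refine ⟨y, ?_, rfl⟩
  intro p hp
  by_cases hp0 : p = 0
  · simp [hp0]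
  have hpK : algebraMap A K p ≠ 0 := by simpa using hp0
  have hle : FractionalIdeal.spanSingleton A⁰ (algebraMap A K p) *
      (auxC a P : FractionalIdeal A⁰ K) ≤
      FractionalIdeal.spanSingleton A⁰ (algebraMap A K a) * 1 := by
    rw [FractionalIdeal.spanSingleton_mul_le_iff]
    intro z hz
    rw [FractionalIdeal.mem_coeIdeal] at hz
    obtain ⟨z, hz, rfl⟩ := hz
    obtain ⟨w, hw⟩ := Ideal.mem_span_singleton'.1 (hz p hp)
    rw [mul_one, FractionalIdeal.mem_spanSingleton]
    refine ⟨w, ?_⟩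
    rw [Algebra.smul_def, ← map_mul, ← map_mul, hw, mul_comm]
  have hne : FractionalIdeal.spanSingleton A⁰ (algebraMap A K p) *
      (auxC a P : FractionalIdeal A⁰ K) ≠ 0 := by
    intro h
    apply hC0
    have h' := congrArg (FractionalIdeal.spanSingleton A⁰ (algebraMap A K p)⁻¹ * ·) h
    simpa [← mul_assoc, FractionalIdeal.spanSingleton_mul_spanSingleton, hp0] using h'
  have h2 := s.mono _ _ hne hle
  rw [s.star_smul _ hpK _ hC0, s.star_smul _ haK _ one_ne_zero, s.star_one, mul_one,
    FractionalIdeal.spanSingleton_mul_le_iff] at h2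
  have h3 := h2 _ hx
  rw [FractionalIdeal.mem_spanSingleton] at h3
  obtain ⟨w, hw⟩ := h3
  rw [Algebra.smul_def, ← map_mul, ← map_mul] at hw
  have := IsFractionRing.injective A K hw
  rw [Ideal.mem_span_singleton']
  exact ⟨w, by rw [this, mul_comm]⟩

/-- The ideal with carrier `prodSet F a`. -/
def prodIdeal {A : Type*} [CommRing A] (F : Set (Ideal A)) (a : A) : Ideal A where
  carrier := prodSet F a
  zero_mem' := ⟨∅, by simp, by simp⟩
  add_mem' := by
    classical
    rintro x y ⟨G, hG, hx⟩ ⟨H, hH, hy⟩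
    refine ⟨G ∪ H, by simp [hG, hH], ?_⟩
    rw [← auxC_iff] at *
    exact Ideal.add_mem _ (auxC_anti a (prod_anti Finset.subset_union_left) hx)
      (auxC_anti a (prod_anti Finset.subset_union_right) hy)
  smul_mem' := by
    rintro c x ⟨G, hG, hx⟩
    refine ⟨G, hG, ?_⟩
    rw [← auxC_iff] at *
    exact Ideal.mul_mem_left _ _ hx

lemma star_fg_le (s : StarOperation A K) (a : A) (ha : a ≠ 0) (F : Set (Ideal A))
    (J : FractionalIdeal A⁰ K) (hJ : J ≠ 0) (hJF : J ≤ (prodIdeal F a : FractionalIdeal A⁰ K))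
    (hfg : (J : Submodule A K).FG) :
    s.star J ≤ (prodIdeal F a : FractionalIdeal A⁰ K) := by
  classical
  obtain ⟨T, hT⟩ := hfg
  have key : ∀ t : T, ∃ G : Finset (Ideal A), ↑G ⊆ F ∧
      (t : K) ∈ (auxC a (G.prod id) : FractionalIdeal A⁰ K) := by
    intro t
    have h1 : (t : K) ∈ (J : Submodule A K) := hT ▸ Submodule.subset_span t.2
    have h2 := hJF h1
    obtain ⟨y, ⟨G, hG, hy⟩, hyt⟩ := (FractionalIdeal.mem_coeIdeal _).1 h2
    exact ⟨G, hG, (FractionalIdeal.mem_coeIdeal _).2 ⟨y, (auxC_iff _ _ _).2 hy, hyt⟩⟩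
  choose G hG hGt using key
  let H := Finset.univ.biUnion G
  have hH : (H : Set (Ideal A)) ⊆ F := by
    intro I hI
    simp only [H, Finset.coe_biUnion, Set.mem_iUnion] at hI
    obtain ⟨t, _, hI⟩ := hI
    exact hG t hI
  have hle : J ≤ (auxC a (H.prod id) : FractionalIdeal A⁰ K) := by
    rw [← FractionalIdeal.coe_le_coe, ← hT, Submodule.span_le]
    intro t ht
    have h1 : auxC a ((G ⟨t, ht⟩).prod id) ≤ auxC a (H.prod id) :=
      auxC_anti a (prod_anti (Finset.subset_biUnion_of_mem G (Finset.mem_univ _)))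
    exact (FractionalIdeal.coeIdeal_le_coeIdeal K).2 h1 (hGt ⟨t, ht⟩)
  refine (s.mono _ _ hJ hle).trans ((star_auxC s a ha _).trans ?_)
  rw [FractionalIdeal.coeIdeal_le_coeIdeal]
  intro y hy
  exact ⟨H, hH, (auxC_iff _ _ _).1 hy⟩

/-- Let `⋆` be a finite type star operation on `A`, `a ≠ 0`, and `ℱ` a collection of
ideals of `A` each containing `a`. Then
`𝔞 = {x : x·∏ℱ' ⊆ aA for some finite ℱ' ⊆ ℱ}` is a ⋆-ideal of `A`, and for any
`x₁, …, xₙ ∈ 𝔞` one has `(x₁, …, xₙ)^⋆ ⊆ 𝔞`. -/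
theorem prodSet_isStarIdeal
    (s : StarOperation A K) (hs : s.IsFiniteType) (a : A) (ha : a ≠ 0)
    (F : Set (Ideal A)) (hF : ∀ I ∈ F, a ∈ I) :
    ∃ 𝔞 : Ideal A, (𝔞 : Set A) = prodSet F a ∧ IsStarIdeal s 𝔞 ∧
      ∀ T : Finset A, (T : Set A) ⊆ prodSet F a → Ideal.span (T : Set A) ≠ ⊥ →
        s.star ↑(Ideal.span (T : Set A)) ≤ (𝔞 : FractionalIdeal A⁰ K) := by
  have ha' : a ∈ prodIdeal F a := ⟨∅, by simp, by simp⟩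
  have h0 : prodIdeal F a ≠ 0 := by
    intro h
    rw [h] at ha'
    exact ha (by simpa using ha')
  have h0' : (prodIdeal F a : FractionalIdeal A⁰ K) ≠ 0 :=
    FractionalIdeal.coeIdeal_ne_zero.2 h0
  refine ⟨prodIdeal F a, rfl, ⟨h0, le_antisymm ?_ (s.le_star _ h0')⟩, ?_⟩
  · intro x hx
    obtain ⟨J, hJ, hJle, hfg, hxJ⟩ := hs _ h0' x hx
    exact star_fg_le s a ha F J hJ hJle hfg hxJ
  · intro T hT hT0
    refine star_fg_le s a ha F _ (FractionalIdeal.coeIdeal_ne_zero.2 hT0) ?_ ?_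
    · rw [FractionalIdeal.coeIdeal_le_coeIdeal, Ideal.span_le]
      exact hT
    · rw [FractionalIdeal.coe_coeIdeal]
      exact Submodule.FG.map _ ⟨T, rfl⟩
end

section
/- Let A be an integral domain, ⋆ a star operation of finite type on A, and a a nonzero element of A. Assume that every ⋆-locally principal ideal of A is ⋆-invertible. Then every ⋆-comaximal collection over a consisting of ⋆-invertible ⋆-ideals of A is finite. -/
open scoped nonZeroDivisors

variable {A : Type*} [CommRing A] [IsDomain A]
  {K : Type*} [Field K] [Algebra A K] [IsFractionRing A K]

/-- A (nonzero) ideal `I` is ⋆-invertible if `(I·I⁻¹)^⋆ = A`, where `I⁻¹ = (A : I)`. -/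
def IsStarInvertible (s : StarOperation A K) (I : Ideal A) : Prop :=
  I ≠ 0 ∧ s.star ((I : FractionalIdeal A⁰ K) * (1 / (I : FractionalIdeal A⁰ K))) = 1

section helpers

theorem sh_coe_ne {I : Ideal A} (hI : I ≠ 0) : (I : FractionalIdeal A⁰ K) ≠ 0 :=
  FractionalIdeal.coeIdeal_ne_zero.mpr hI

theorem sh_mul_ne {I J : FractionalIdeal A⁰ K} (hI : I ≠ 0) (hJ : J ≠ 0) : I * J ≠ 0 := by
  intro h
  have ex : ∀ I : FractionalIdeal A⁰ K, I ≠ 0 → ∃ x ∈ I, x ≠ 0 := by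
    intro I hI
    by_contra hcon
    push Not at hcon
    exact hI (FractionalIdeal.eq_zero_iff.mpr hcon)
  obtain ⟨x, hx, hx0⟩ := ex I hI
  obtain ⟨y, hy, hy0⟩ := ex J hJ
  exact mul_ne_zero hx0 hy0
    (FractionalIdeal.eq_zero_iff.mp h _ (FractionalIdeal.mul_mem_mul hx hy))

theorem sh_cancel (s : StarOperation A K) (T B : FractionalIdeal A⁰ K) (hB : B ≠ 0)
    (hB1 : s.star B = 1) (hTB : T * B ≤ 1) : T ≤ 1 := by
  intro z hz
  by_cases hz0 : z = 0
  · subst hz0; exact Submodule.zero_mem _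
  have h1 : FractionalIdeal.spanSingleton A⁰ z * B ≤ 1 :=
    le_trans (mul_le_mul_left (FractionalIdeal.spanSingleton_le_iff_mem.mpr hz) B) hTB
  have hne : FractionalIdeal.spanSingleton A⁰ z * B ≠ 0 :=
    sh_mul_ne (FractionalIdeal.spanSingleton_ne_zero_iff.mpr hz0) hB
  have h2 := s.mono _ _ hne h1
  rw [s.star_smul z hz0 B hB, hB1, s.star_one, mul_one] at h2
  exact FractionalIdeal.spanSingleton_le_iff_mem.mp h2

theorem sh_top (s : StarOperation A K) {I : Ideal A} (hI : IsStarIdeal s I)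
    (B : FractionalIdeal A⁰ K) (hB : B ≠ 0) (hB1 : s.star B = 1)
    (hle : B ≤ (I : FractionalIdeal A⁰ K)) : I = ⊤ := by
  have h := s.mono _ _ hB hle
  rw [hB1, hI.2] at h
  rw [← FractionalIdeal.coeIdeal_top (S := A⁰) (P := K)] at h
  exact top_le_iff.mp (FractionalIdeal.coeIdeal_le_coeIdeal K |>.mp h)

theorem sh_inv_ne {I : Ideal A} (hI : I ≠ 0) :
    (I : FractionalIdeal A⁰ K) * (1 / (I : FractionalIdeal A⁰ K)) ≠ 0 := by
  have hI' := sh_coe_ne (K := K) hI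
  refine sh_mul_ne hI' fun h0 => ?_
  have : (1 : K) ∈ (1 / (I : FractionalIdeal A⁰ K)) := by
    rw [FractionalIdeal.mem_div_iff_of_ne_zero hI']
    intro y hy
    rw [one_mul]
    exact FractionalIdeal.coeIdeal_le_one hy
  rw [h0] at this
  exact one_ne_zero ((FractionalIdeal.mem_zero_iff A⁰).mp this)

/-- `(a) : I` as an ideal. -/
def shQ (a : A) (I : Ideal A) : Ideal A where
  carrier := {x | ∀ y ∈ I, a ∣ x * y}
  zero_mem' := fun y _ => by simp
  add_mem' := fun {x x'} hx hx' y hy => by rw [add_mul]; exact dvd_add (hx y hy) (hx' y hy)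
  smul_mem' := fun c x hx y hy => by
    rw [smul_eq_mul, mul_assoc]; exact (hx y hy).mul_left c

theorem sh_lift (a : A) {I : Ideal A} (hI : I ≠ 0) (haI : a ∈ I) (z : K)
    (hz : z ∈ (1 / (I : FractionalIdeal A⁰ K))) :
    ∃ q ∈ shQ a I, algebraMap A K q = algebraMap A K a * z := by
  rw [FractionalIdeal.mem_div_iff_of_ne_zero (sh_coe_ne hI)] at hz
  have hA : ∀ y ∈ I, ∃ d : A, algebraMap A K d = z * algebraMap A K y := fun y hy =>
    (FractionalIdeal.mem_one_iff A⁰).mp (hz _ (FractionalIdeal.mem_coeIdeal_of_mem A⁰ hy))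
  obtain ⟨q, hq⟩ := hA a haI
  refine ⟨q, fun y hy => ?_, by rw [hq, mul_comm]⟩
  obtain ⟨d, hd⟩ := hA y hy
  refine ⟨d, IsFractionRing.injective A K ?_⟩
  rw [map_mul, map_mul, hq, hd]; ring

theorem sh_local_elt (s : StarOperation A K) (a : A) {I m : Ideal A}
    (ha : a ≠ 0) (haI : a ∈ I) (hI : IsStarInvertible s I) (hm : IsStarMaximal s m) :
    ∃ x ∈ I, ∃ q ∈ shQ a I, ∃ c, c ∉ m ∧ q * x = a * c := by
  by_contra hcon
  push Not at hcon
  refine hm.1 (sh_top s hm.2.1 _ (sh_inv_ne hI.1) hI.2 ?_)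
  rw [FractionalIdeal.mul_le]
  intro x hx z hz
  obtain ⟨x, hxI, rfl⟩ := (FractionalIdeal.mem_coeIdeal A⁰).mp hx
  obtain ⟨q, hq, hqz⟩ := sh_lift a hI.1 haI z hz
  obtain ⟨c, hc⟩ := hq x hxI
  have hcm : c ∈ m := by
    by_contra hcm
    exact hcon x hxI q hq c hcm hc
  refine (FractionalIdeal.mem_coeIdeal A⁰).mpr ⟨c, hcm, ?_⟩
  have ha' : algebraMap A K a ≠ 0 := by
    simpa using ha
  have := congrArg (algebraMap A K) hc
  rw [map_mul, map_mul, hqz] at this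
  apply mul_left_cancel₀ ha'
  rw [← this]; ring

theorem sh_local (s : StarOperation A K) (a : A) (ha : a ≠ 0) (F : Set (Ideal A))
    (hne : F.Nonempty) (hF : IsStarComaximalOver s a F)
    (hinv : ∀ I ∈ F, IsStarIdeal s I ∧ IsStarInvertible s I)
    (m : Ideal A) [m.IsPrime] (hm : IsStarMaximal s m) :
    ((⨆ I : F, shQ a I.1).map (algebraMap A (Localization.AtPrime m))).IsPrincipal := by
  obtain ⟨I₀, hI₀, hoth⟩ : ∃ I₀ ∈ F, ∀ I ∈ F, I ≠ I₀ → ¬ I ≤ m := by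
    by_cases hex : ∃ I ∈ F, I ≤ m
    · obtain ⟨I₀, h0, h0m⟩ := hex
      refine ⟨I₀, h0, fun I hI hne hIm => hm.1 ?_⟩
      refine sh_top s hm.2.1 _ (sh_coe_ne ?_) (hF.2 I hI I₀ h0 hne) ?_
      · intro h00
        exact (hinv I hI).1.1 (le_bot_iff.mp (le_sup_left.trans h00.le))
      · exact (FractionalIdeal.coeIdeal_le_coeIdeal K).mpr (sup_le hIm h0m)
    · push Not at hex
      obtain ⟨I₀, h0⟩ := hne
      exact ⟨I₀, h0, fun I hI _ => hex I hI⟩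
  obtain ⟨x, hx, q, hq, c, hc, hqx⟩ := sh_local_elt s a ha (hF.1 _ hI₀) (hinv _ hI₀).2 hm
  have key : ∀ u r : A, u ∉ m → q ∣ u * r → algebraMap A (Localization.AtPrime m) r ∈
      Ideal.span {algebraMap A (Localization.AtPrime m) q} := by
    intro u r hu hd
    rw [Ideal.mem_span_singleton]
    have hun : IsUnit (algebraMap A (Localization.AtPrime m) u) :=
      IsLocalization.map_units (Localization.AtPrime m) (⟨u, hu⟩ : m.primeCompl)
    have := map_dvd (algebraMap A (Localization.AtPrime m)) hd
    rw [map_mul] at this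
    exact (hun.dvd_mul_left).mp this
  refine ⟨⟨algebraMap A (Localization.AtPrime m) q, le_antisymm ?_ ?_⟩⟩
  · rw [Ideal.map_le_iff_le_comap]
    refine iSup_le ?_
    rintro ⟨I, hI⟩ r hr
    rw [Ideal.mem_comap]
    by_cases hII : I = I₀
    · subst hII
      obtain ⟨d, hd⟩ := hr x hx
      refine key c r hc ⟨d, mul_left_cancel₀ ha ?_⟩
      linear_combination (-r) * hqx + q * hd
    · obtain ⟨t, htI, htm⟩ := Set.not_subset.mp (hoth I hI hII)
      obtain ⟨d, hd⟩ := hr t htI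
      refine key (c * t) r ?_ ⟨x * d, ?_⟩
      · exact fun hct => (Ideal.IsPrime.mem_or_mem ‹_› hct).elim hc htm
      · linear_combination c * hd - d * hqx
  · rw [Submodule.span_le, Set.singleton_subset_iff]
    exact Ideal.mem_map_of_mem _ ((le_iSup (fun I : F => shQ a I.1) ⟨I₀, hI₀⟩) hq)

theorem sh_strip (s : StarOperation A K) (a : A) (F : Set (Ideal A))
    (hF : IsStarComaximalOver s a F)
    (hinv : ∀ I ∈ F, IsStarIdeal s I ∧ IsStarInvertible s I)
    (M : F) (T : FractionalIdeal A⁰ K) (hT : T * (M.1 : FractionalIdeal A⁰ K) ≤ 1)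
    (S : Finset F) (hS : M ∉ S)
    (hTS : T * ∏ I ∈ S, (I.1 : FractionalIdeal A⁰ K) ≤ 1) : T ≤ 1 := by
  classical
  induction S using Finset.induction_on with
  | empty => simpa using hTS
  | insert I S hIS ih =>
    refine ih (fun h => hS (Finset.mem_insert_of_mem h)) ?_
    rw [Finset.prod_insert hIS] at hTS
    have hne : I.1 ≠ M.1 := fun h => hS (by
      rw [← Subtype.ext h]; exact Finset.mem_insert_self _ _)
    refine sh_cancel s _ _ (sh_coe_ne ?_) (hF.2 I.1 I.2 M.1 M.2 hne) ?_
    · intro h00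
      exact (hinv I.1 I.2).1.1 (le_bot_iff.mp (le_sup_left.trans h00.le))
    · have hP : ∏ I ∈ S, (I.1 : FractionalIdeal A⁰ K) ≤ 1 :=
        Finset.prod_le_one' fun i _ => FractionalIdeal.coeIdeal_le_one
      have hsup : ((I.1 + M.1 : Ideal A) : FractionalIdeal A⁰ K) = I.1 + M.1 :=
        FractionalIdeal.coeIdeal_sup _ _
      rw [hsup, mul_add, ← FractionalIdeal.sup_eq_add]
      refine sup_le ?_ ?_
      · calc _ = T * (↑I.1 * ∏ I ∈ S, (I.1 : FractionalIdeal A⁰ K)) := by ring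
          _ ≤ 1 := hTS
      · calc _ = (T * ↑M.1) * ∏ I ∈ S, (I.1 : FractionalIdeal A⁰ K) := by ring
          _ ≤ 1 := mul_le_one' hT hP

/-- A finitely generated `J ≤ (⨆ Q_i) W` is contained in the part from finitely many indices. -/
theorem sh_fin {ι : Type*} (Q : ι → Ideal A) (W J : FractionalIdeal A⁰ K)
    (hJ : (J : Submodule A K).FG) (hle : J ≤ ((⨆ i, Q i : Ideal A) : FractionalIdeal A⁰ K) * W) :
    ∃ S : Finset ι, ∀ R B : FractionalIdeal A⁰ K,
      (∀ i ∈ S, (Q i : FractionalIdeal A⁰ K) * W * R ≤ B) → J * R ≤ B := by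
  have h1 : (J : Submodule A K) ≤
      ⨆ i, ((((Q i : FractionalIdeal A⁰ K) * W : FractionalIdeal A⁰ K)) : Submodule A K) := by
    refine (FractionalIdeal.coe_le_coe.mpr hle).trans ?_
    simp only [FractionalIdeal.coe_mul, FractionalIdeal.coe_coeIdeal,
      IsLocalization.coeSubmodule, Submodule.map_iSup]
    rw [Submodule.iSup_mul]
  obtain ⟨S, hS⟩ := CompleteLattice.IsCompactElement.exists_finset_of_le_iSup _
    ((Submodule.fg_iff_compact _).mp hJ) _ h1
  refine ⟨S, fun R B hB => ?_⟩
  rw [← FractionalIdeal.coe_le_coe, FractionalIdeal.coe_mul]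
  refine (mul_le_mul' hS le_rfl).trans ?_
  simp only [Submodule.iSup_mul]
  refine iSup₂_le fun i hi => ?_
  rw [← FractionalIdeal.coe_mul]
  exact FractionalIdeal.coe_le_coe.mpr (hB i hi)

end helpers

/-- Let `⋆` be a finite type star operation on `A` and `a ≠ 0`. If every nonzero
⋆-locally principal ideal of `A` (principal in `A_𝔪` for each ⋆-maximal, hence prime,
ideal `𝔪`) is ⋆-invertible, then every ⋆-comaximal collection over `a` of ⋆-invertible
⋆-ideals is finite. -/
theorem comaximal_family_of_star_invertible_finite
    (s : StarOperation A K) (hs : s.IsFiniteType) (a : A) (ha : a ≠ 0)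
    (h : ∀ I : Ideal A, I ≠ 0 →
      (∀ (𝔪 : Ideal A) [𝔪.IsPrime], IsStarMaximal s 𝔪 →
        (I.map (algebraMap A (Localization.AtPrime 𝔪))).IsPrincipal) →
      IsStarInvertible s I) :
    ∀ F : Set (Ideal A), IsStarComaximalOver s a F →
      (∀ I ∈ F, IsStarIdeal s I ∧ IsStarInvertible s I) → F.Finite := by
  classical
  intro F hF hinv
  rcases F.eq_empty_or_nonempty with rfl | hne
  · exact Set.finite_empty
  set Q : F → Ideal A := fun I => shQ a I.1 with hQ
  set I := ⨆ i, Q i with hI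
  have hI0 : I ≠ 0 := by
    obtain ⟨I₀, h0⟩ := hne
    intro hz
    have : a ∈ I := (le_iSup Q ⟨I₀, h0⟩) (fun y _ => dvd_mul_right a y)
    rw [hz] at this
    exact ha this
  have hIinv := h I hI0 fun m _ hm => sh_local s a ha F hne hF hinv m hm
  set W : FractionalIdeal A⁰ K := 1 / (I : FractionalIdeal A⁰ K) with hW
  have hIW : (I : FractionalIdeal A⁰ K) * W ≤ 1 :=
    (FractionalIdeal.mul_one_div_le_one)
  obtain ⟨J, hJ0, hJle, hJfg, hJ1⟩ := hs _ (sh_inv_ne hI0) 1 (by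
    rw [hIinv.2]; exact FractionalIdeal.one_mem_one A⁰)
  have hJs : s.star J = 1 := by
    refine le_antisymm ?_ (FractionalIdeal.one_le.mpr hJ1)
    have := s.mono _ _ hJ0 (hJle.trans hIW)
    rwa [s.star_one] at this
  obtain ⟨S, hS⟩ := sh_fin Q W J hJfg hJle
  refine ((S.image Subtype.val).finite_toSet.union (Set.finite_singleton ⊤)).subset ?_
  intro M hM
  by_cases hMS : (⟨M, hM⟩ : F) ∈ S
  · left; simpa using ⟨hM, hMS⟩
  right
  obtain ⟨hMstar, hMinv⟩ := hinv M hM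
  set T : FractionalIdeal A⁰ K := 1 / (M : FractionalIdeal A⁰ K) with hT
  set α : FractionalIdeal A⁰ K := FractionalIdeal.spanSingleton A⁰ (algebraMap A K a) with hα
  have hMT : (M : FractionalIdeal A⁰ K) * T ≤ 1 := FractionalIdeal.mul_one_div_le_one
  have haT : α * T ≤ (I : FractionalIdeal A⁰ K) := by
    rw [FractionalIdeal.spanSingleton_mul_le_iff]
    intro z hz
    obtain ⟨q, hq, hqz⟩ := sh_lift a hMinv.1 (hF.1 M hM) z hz
    rw [← hqz]
    exact FractionalIdeal.mem_coeIdeal_of_mem A⁰ ((le_iSup Q ⟨M, hM⟩) hq)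
  have hT1 : T ≤ 1 := by
    refine sh_strip s a F hF hinv ⟨M, hM⟩ T (by rw [mul_comm]; exact hMT) S hMS ?_
    refine sh_cancel s _ J hJ0 hJs ?_
    rw [mul_comm]
    refine hS _ _ fun i hi => ?_
    have hQi : (Q i : FractionalIdeal A⁰ K) * (i.1 : FractionalIdeal A⁰ K) ≤ α := by
      rw [hα, ← FractionalIdeal.coeIdeal_span_singleton, ← FractionalIdeal.coeIdeal_mul,
        FractionalIdeal.coeIdeal_le_coeIdeal, Ideal.mul_le]
      intro q hq x hx
      exact Ideal.mem_span_singleton.mpr (hq x hx)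
    have hP : ∏ j ∈ S.erase i, (j.1 : FractionalIdeal A⁰ K) ≤ 1 :=
      Finset.prod_le_one' fun i _ => FractionalIdeal.coeIdeal_le_one
    rw [← Finset.mul_prod_erase S _ hi]
    calc _ = (T * W * (Q i * i.1)) * ∏ j ∈ S.erase i, (j.1 : FractionalIdeal A⁰ K) := by ring
      _ ≤ (T * W * α) * 1 := mul_le_mul' (mul_le_mul' le_rfl hQi) hP
      _ = (α * T) * W := by ring
      _ ≤ I * W := mul_le_mul' haT le_rfl
      _ ≤ 1 := hIW
  refine sh_top s hMstar _ (sh_inv_ne hMinv.1) hMinv.2 ?_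
  calc (M : FractionalIdeal A⁰ K) * T ≤ M * 1 := mul_le_mul' le_rfl hT1
    _ = M := mul_one _
end

section
/- Let A be an integral domain in which every t-locally principal t-ideal is t-finite. Then, for any star operation ⋆ of finite type on A, every ⋆-locally principal ⋆-ideal of A is ⋆-finite. In particular, every nonzero locally principal ideal of A (i.e., principal in A_𝔪 for every maximal ideal 𝔪) is finitely generated, and hence invertible. -/
open scoped nonZeroDivisors

variable {A : Type*} [CommRing A] [IsDomain A]
  {K : Type*} [Field K] [Algebra A K] [IsFractionRing A K]

section TOperation

variable (D : Type*) [CommRing D] [IsDomain D]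
  (F : Type*) [Field F] [Algebra D F] [IsFractionRing D F]

/-- The `v`-operation on fractional ideals of `D`: `I^v = (D : (D : I))`. -/
noncomputable def vOp (I : FractionalIdeal D⁰ F) : FractionalIdeal D⁰ F :=
  1 / (1 / I)

/-- The `t`-operation (as a set): `N^t = ⋃ {J^v : J ⊆ N, J a finitely generated
fractional ideal}`. -/
noncomputable def tSet (N : Submodule D F) : Set F :=
  ⋃ J ∈ {J : FractionalIdeal D⁰ F | (J : Submodule D F) ≤ N ∧ (J : Submodule D F).FG},
    (vOp D F J : Set F)

/-- The image of an integral ideal of `D` in `F`, as a `D`-submodule of `F`. -/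
def idlSub (I : Ideal D) : Submodule D F :=
  ((I : FractionalIdeal D⁰ F) : Submodule D F)

/-- A (nonzero) ideal `I` of `D` is a `t`-ideal if `I^t = I`. -/
def IsTIdeal (I : Ideal D) : Prop :=
  I ≠ 0 ∧ tSet D F (idlSub D F I) = (idlSub D F I : Set F)

/-- A (nonzero) ideal `I` of `D` is `t`-finite if `J^t = I^t` for some finitely
generated (nonzero) ideal `J`. -/
def IsTFinite (I : Ideal D) : Prop :=
  I ≠ 0 ∧ ∃ J : Ideal D, J ≠ 0 ∧ J.FG ∧ tSet D F (idlSub D F J) = tSet D F (idlSub D F I)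

/-- An ideal of `D` is `t`-maximal if it is maximal among proper `t`-ideals. -/
def IsTMaximal (M : Ideal D) : Prop :=
  M ≠ ⊤ ∧ IsTIdeal D F M ∧ ∀ J : Ideal D, J ≠ ⊤ → IsTIdeal D F J → M ≤ J → J = M

/-- `D` has the `t`-finite character if every nonzero element of `D` lies in only
finitely many `t`-maximal ideals. -/
def HasTFiniteCharacter : Prop :=
  ∀ a : D, a ≠ 0 → {M : Ideal D | IsTMaximal D F M ∧ a ∈ M}.Finite

/-- A (nonzero) ideal `I` of `D` is `t`-invertible if `(I·I⁻¹)^t = D`, where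
`I⁻¹ = (D : I)`. -/
def IsTInvertible (I : Ideal D) : Prop :=
  I ≠ 0 ∧ tSet D F
      (((I : FractionalIdeal D⁰ F) * (1 / (I : FractionalIdeal D⁰ F)) :
        FractionalIdeal D⁰ F) : Submodule D F) =
    (((1 : FractionalIdeal D⁰ F) : Submodule D F) : Set F)

/-- `D` is `v`-coherent: for every nonzero finitely generated ideal `I`,
`I⁻¹ = J^v` for some finitely generated (nonzero) fractional ideal `J`. -/
def IsVCoherent : Prop :=
  ∀ I : Ideal D, I ≠ 0 → I.FG →
    ∃ J : FractionalIdeal D⁰ F, J ≠ 0 ∧ (J : Submodule D F).FG ∧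
      1 / (I : FractionalIdeal D⁰ F) = vOp D F J

/-- `D` is a PvMD if every nonzero finitely generated ideal of `D` is `t`-invertible. -/
def IsPvMD : Prop :=
  ∀ I : Ideal D, I ≠ 0 → I.FG → IsTInvertible D F I

/-- `D` is a GCD domain: any two elements have a greatest common divisor. -/
def IsGCDDomain (D : Type*) [CommRing D] [IsDomain D] : Prop :=
  ∀ a b : D, ∃ d : D, d ∣ a ∧ d ∣ b ∧ ∀ c : D, c ∣ a → c ∣ b → c ∣ d

end TOperation

/-- A nonzero ideal `I` is `t`-locally principal: `IA_M` is principal for every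
`t`-maximal (prime) ideal `M`. -/
def TLocallyPrincipal' (I : Ideal A) : Prop :=
  ∀ (M : Ideal A) [M.IsPrime], IsTMaximal A K M →
    (I.map (algebraMap A (Localization.AtPrime M))).IsPrincipal

/-- A nonzero ideal `I` is ⋆-locally principal: `IA_𝔪` is principal for every
⋆-maximal (prime) ideal `𝔪`. -/
def StarLocallyPrincipal (s : StarOperation A K) (I : Ideal A) : Prop :=
  ∀ (𝔪 : Ideal A) [𝔪.IsPrime], IsStarMaximal s 𝔪 →
    (I.map (algebraMap A (Localization.AtPrime 𝔪))).IsPrincipal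


namespace StarAux

set_option linter.unusedSectionVars false

open FractionalIdeal

lemma mem_one_alg (x : A) : algebraMap A K x ∈ (1 : FractionalIdeal A⁰ K) :=
  (FractionalIdeal.mem_one_iff A⁰).mpr ⟨x, rfl⟩

lemma alg_mem {I : Ideal A} {x : A} :
    algebraMap A K x ∈ (I : FractionalIdeal A⁰ K) ↔ x ∈ I := by
  rw [FractionalIdeal.mem_coeIdeal]
  constructor
  · rintro ⟨y, hy, h⟩
    rwa [← IsFractionRing.injective A K h]
  · intro h
    exact ⟨x, h, rfl⟩

lemma coe_ne {I : Ideal A} (h : I ≠ 0) : (I : FractionalIdeal A⁰ K) ≠ 0 :=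
  FractionalIdeal.coeIdeal_ne_zero.mpr h

/-- basic property of the v-closure -/
lemma vOp_mul_mem {J : FractionalIdeal A⁰ K} {x z : K} (hx : x ∈ vOp A K J)
    (hz : ∀ y ∈ J, z * y ∈ (1 : FractionalIdeal A⁰ K)) :
    x * z ∈ (1 : FractionalIdeal A⁰ K) := by
  unfold vOp at hx
  by_cases h1 : (1 / J : FractionalIdeal A⁰ K) = 0
  · rw [h1, FractionalIdeal.div_zero] at hx
    rw [FractionalIdeal.mem_zero_iff] at hx
    rw [hx, zero_mul]
    exact FractionalIdeal.zero_mem _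
  · have hJ : J ≠ 0 := by
      rintro rfl
      exact h1 FractionalIdeal.div_zero
    exact (FractionalIdeal.mem_div_iff_of_ne_zero h1).mp hx z
      ((FractionalIdeal.mem_div_iff_of_ne_zero hJ).mpr hz)

lemma one_div_ne {J : FractionalIdeal A⁰ K} (h : J ≠ 0) (h1 : J ≤ 1) :
    (1 / J : FractionalIdeal A⁰ K) ≠ 0 := by
  intro h0
  have : (1 : K) ∈ (1 / J : FractionalIdeal A⁰ K) :=
    (FractionalIdeal.mem_div_iff_of_ne_zero h).mpr (fun y hy => by
      rw [one_mul]; exact h1 hy)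
  rw [h0, FractionalIdeal.mem_zero_iff] at this
  exact one_ne_zero this

lemma mem_vOp {J : FractionalIdeal A⁰ K} (h : J ≠ 0) (h1 : J ≤ 1) {x : K}
    (hx : ∀ z : K, (∀ y ∈ J, z * y ∈ (1 : FractionalIdeal A⁰ K)) →
      x * z ∈ (1 : FractionalIdeal A⁰ K)) : x ∈ vOp A K J := by
  unfold vOp
  rw [FractionalIdeal.mem_div_iff_of_ne_zero (one_div_ne h h1)]
  intro z hz
  exact hx z ((FractionalIdeal.mem_div_iff_of_ne_zero h).mp hz)

lemma le_vOp {J : FractionalIdeal A⁰ K} (h : J ≠ 0) (h1 : J ≤ 1) : J ≤ vOp A K J := by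
  intro x hx
  exact mem_vOp h h1 (fun z hz => by rw [mul_comm]; exact hz x hx)

lemma star_le_one (s : StarOperation A K) {J : FractionalIdeal A⁰ K} (h : J ≠ 0) (h1 : J ≤ 1) :
    s.star J ≤ 1 := by
  rw [← s.star_one]
  exact s.mono J 1 h h1

lemma frac_mul_ne {I J : FractionalIdeal A⁰ K} (hI : I ≠ 0) (hJ : J ≠ 0) : I * J ≠ 0 := by
  obtain ⟨x, hx, hx0⟩ : ∃ y ∈ I, y ≠ 0 := by
    by_contra! hcon
    exact hI (FractionalIdeal.eq_zero_iff.mpr hcon)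
  obtain ⟨y, hy, hy0⟩ : ∃ y ∈ J, y ≠ 0 := by
    by_contra! hcon
    exact hJ (FractionalIdeal.eq_zero_iff.mpr hcon)
  intro h
  have h1 := FractionalIdeal.mul_mem_mul hx hy
  rw [h, FractionalIdeal.mem_zero_iff] at h1
  exact mul_ne_zero hx0 hy0 h1

lemma span_ne {z : K} (hz : z ≠ 0) {J : FractionalIdeal A⁰ K} (h : J ≠ 0) :
    FractionalIdeal.spanSingleton A⁰ z * J ≠ 0 :=
  frac_mul_ne (FractionalIdeal.spanSingleton_ne_zero_iff.mpr hz) h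

/-- scaling: if `zJ ⊆ N` and `x ∈ J^⋆` then `zx ∈ N^⋆`. -/
lemma mul_mem_star (s : StarOperation A K) {J N : FractionalIdeal A⁰ K} (h : J ≠ 0) {z x : K}
    (hzJ : ∀ y ∈ J, z * y ∈ N) (hx : x ∈ s.star J) : z * x ∈ s.star N := by
  by_cases hz : z = 0
  · rw [hz, zero_mul]; exact FractionalIdeal.zero_mem _
  · have h2 : FractionalIdeal.spanSingleton A⁰ z * J ≤ N :=
      FractionalIdeal.spanSingleton_mul_le_iff.mpr hzJ
    have h3 := s.mono _ _ (span_ne hz h) h2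
    rw [s.star_smul z hz J h] at h3
    exact h3 (FractionalIdeal.mem_singleton_mul.mpr ⟨x, hx, rfl⟩)

lemma star_le_vOp (s : StarOperation A K) {J : FractionalIdeal A⁰ K} (h : J ≠ 0) (h1 : J ≤ 1) :
    s.star J ≤ vOp A K J := by
  intro x hx
  refine mem_vOp h h1 (fun z hz => ?_)
  rw [mul_comm, ← s.star_one]
  exact mul_mem_star s h hz hx

lemma exists_starIdeal (s : StarOperation A K) {Q : Ideal A} (h : Q ≠ 0) :
    ∃ N : Ideal A, (N : FractionalIdeal A⁰ K) = s.star Q ∧ IsStarIdeal s N ∧ Q ≤ N := by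
  obtain ⟨N, hN⟩ := FractionalIdeal.le_one_iff_exists_coeIdeal.mp
    (star_le_one s (coe_ne h) (FractionalIdeal.coeIdeal_le_one (I := Q)))
  have hQN : Q ≤ N := by
    rw [← FractionalIdeal.coeIdeal_le_coeIdeal K, hN]
    exact s.le_star _ (coe_ne h)
  refine ⟨N, hN, ⟨?_, ?_⟩, hQN⟩
  · intro h0
    apply h
    rw [h0] at hQN
    exact le_bot_iff.mp hQN
  · rw [hN, s.star_idem _ (coe_ne h)]

lemma isStarIdeal_of_le (s : StarOperation A K) {N : Ideal A} (h : N ≠ 0)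
    (hle : ∀ x : K, x ∈ s.star (N : FractionalIdeal A⁰ K) → x ∈ (N : FractionalIdeal A⁰ K)) :
    IsStarIdeal s N :=
  ⟨h, le_antisymm hle (s.le_star _ (coe_ne h))⟩

/-- star-maximal ideals are prime -/
lemma starMaximal_prime (s : StarOperation A K) {M : Ideal A} (hM : IsStarMaximal s M) :
    M.IsPrime := by
  obtain ⟨hT, ⟨h0, hs⟩, hmax⟩ := hM
  refine ⟨hT, ?_⟩
  intro a b hab
  by_contra! hcon
  obtain ⟨ha, hb⟩ := hcon
  have hQ : M ⊔ Ideal.span {a} ≠ 0 := by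
    intro h
    apply h0
    have : M ≤ M ⊔ Ideal.span {a} := le_sup_left
    rw [h] at this
    exact le_bot_iff.mp this
  obtain ⟨N, hN, hNs, hle⟩ := exists_starIdeal s hQ
  have haN : a ∈ N := hle (Ideal.mem_sup_right (Ideal.mem_span_singleton_self a))
  have hNT : N = ⊤ := by
    by_contra hne
    have := hmax N hne hNs (le_sup_left.trans hle)
    rw [this] at haN
    exact ha haN
  have h1 : (1 : K) ∈ s.star ((M ⊔ Ideal.span {a} : Ideal A) : FractionalIdeal A⁰ K) := by
    rw [← hN, hNT]
    have := (alg_mem (K := K) (I := (⊤ : Ideal A)) (x := 1)).mpr trivial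
    rwa [map_one] at this
  have h2 := mul_mem_star s (N := (M : FractionalIdeal A⁰ K)) (coe_ne hQ)
    (z := algebraMap A K b) ?_ h1
  · rw [mul_one, hs, alg_mem] at h2
    exact hb h2
  · intro y hy
    obtain ⟨y, hyy, rfl⟩ := (FractionalIdeal.mem_coeIdeal A⁰).mp hy
    rw [← map_mul, alg_mem]
    obtain ⟨m, hm, c, hc, rfl⟩ := Submodule.mem_sup.mp hyy
    obtain ⟨d, rfl⟩ := Ideal.mem_span_singleton'.mp hc
    have : b * (m + d * a) = b * m + d * (a * b) := by ring
    rw [this]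
    exact M.add_mem (M.mul_mem_left _ hm) (M.mul_mem_left _ hab)

lemma exists_starMaximal (s : StarOperation A K) (hs : s.IsFiniteType) {N : Ideal A}
    (hT : N ≠ ⊤) (hN : IsStarIdeal s N) : ∃ M, N ≤ M ∧ IsStarMaximal s M := by
  suffices hz : ∀ c ⊆ {P : Ideal A | P ≠ ⊤ ∧ IsStarIdeal s P}, IsChain (· ≤ ·) c → ∀ y ∈ c,
      ∃ ub ∈ {P : Ideal A | P ≠ ⊤ ∧ IsStarIdeal s P}, ∀ z ∈ c, z ≤ ub by
    obtain ⟨M, hNM, hM⟩ :=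
      zorn_le_nonempty₀ {P : Ideal A | P ≠ ⊤ ∧ IsStarIdeal s P} hz N ⟨hT, hN⟩
    refine ⟨M, hNM, hM.prop.1, hM.prop.2, ?_⟩
    intro J hJ hJs hMJ
    exact le_antisymm (hM.le_of_ge ⟨hJ, hJs⟩ hMJ) hMJ
  · intro c hc hchain y hy
    have hdir : DirectedOn (· ≤ ·) c := hchain.directedOn
    refine ⟨sSup c, ⟨?_, ?_⟩, fun z hz => le_sSup hz⟩
    · intro h
      have h1 : (1 : A) ∈ sSup c := by rw [h]; trivial
      obtain ⟨P, hP, h1P⟩ := (Submodule.mem_sSup_of_directed ⟨y, hy⟩ hdir).mp h1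
      exact (hc hP).1 ((Ideal.eq_top_iff_one P).mpr h1P)
    · have h0 : sSup c ≠ 0 := by
        intro h
        have : y ≤ sSup c := le_sSup hy
        rw [h] at this
        exact (hc hy).2.1 (le_bot_iff.mp this)
      refine isStarIdeal_of_le s h0 (fun x hx => ?_)
      obtain ⟨J, hJ0, hJle, hJfg, hxJ⟩ := hs _ (coe_ne h0) x hx
      obtain ⟨J, rfl⟩ := FractionalIdeal.le_one_iff_exists_coeIdeal.mp
        (hJle.trans FractionalIdeal.coeIdeal_le_one)
      rw [FractionalIdeal.coeIdeal_le_coeIdeal] at hJle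
      rw [FractionalIdeal.coeIdeal_fg A⁰ (IsFractionRing.injective A K)] at hJfg
      obtain ⟨P, hP, hJP⟩ : ∃ P ∈ c, J ≤ P :=
        (CompleteLattice.isCompactElement_iff_le_of_directed_sSup_le _ J).mp
          ((Submodule.fg_iff_compact J).mp hJfg) c ⟨y, hy⟩ hdir hJle
      have h3 := s.mono _ _ hJ0 ((FractionalIdeal.coeIdeal_le_coeIdeal K).mpr hJP) hxJ
      rw [(hc hP).2.2] at h3
      exact (FractionalIdeal.coeIdeal_le_coeIdeal K).mpr (le_sSup hP) h3

/-- an ideal contained in no star-maximal ideal has closure `A` -/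
lemma star_eq_one (s : StarOperation A K) (hs : s.IsFiniteType) {Q : Ideal A} (h0 : Q ≠ 0)
    (h : ∀ M : Ideal A, M.IsPrime → IsStarMaximal s M → ∃ x ∈ Q, x ∉ M) :
    s.star (Q : FractionalIdeal A⁰ K) = 1 := by
  obtain ⟨N, hN, hNs, hle⟩ := exists_starIdeal s h0
  rw [← hN]
  by_cases hT : N = ⊤
  · rw [hT]; exact FractionalIdeal.coeIdeal_top A⁰
  · obtain ⟨M, hNM, hM⟩ := exists_starMaximal s hs hT hNs
    obtain ⟨x, hx, hxM⟩ := h M (starMaximal_prime s hM) hM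
    exact absurd (hNM (hle hx)) hxM

/-- elementwise form of local principality -/
lemma locPrin_elem {I M : Ideal A} [M.IsPrime]
    (h : (I.map (algebraMap A (Localization.AtPrime M))).IsPrincipal) :
    ∃ a ∈ I, ∀ x ∈ I, ∃ t, t ∉ M ∧ a ∣ t * x := by
  obtain ⟨g, hg⟩ := h
  have hgI : g ∈ I.map (algebraMap A (Localization.AtPrime M)) := by
    rw [hg]; exact Submodule.mem_span_singleton_self g
  obtain ⟨⟨a, t⟩, hat⟩ := (IsLocalization.mem_map_algebraMap_iff M.primeCompl _).mp hgI
  refine ⟨a, a.2, fun x hx => ?_⟩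
  have hxI := Ideal.mem_map_of_mem (algebraMap A (Localization.AtPrime M)) hx
  rw [hg] at hxI
  obtain ⟨r, hr⟩ := Submodule.mem_span_singleton.mp hxI
  obtain ⟨⟨c, u⟩, hcu⟩ := IsLocalization.surj M.primeCompl r
  refine ⟨u * t, (M.primeCompl.mul_mem u.2 t.2), c, ?_⟩
  apply IsLocalization.injective (Localization.AtPrime M) M.primeCompl_le_nonZeroDivisors
  simp only [map_mul, smul_eq_mul] at hat hcu hr ⊢
  rw [← hr, ← hat, ← hcu]
  ring

lemma locPrin_of_elem {I M : Ideal A} [M.IsPrime] {a : A} (ha : a ∈ I)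
    (h : ∀ x ∈ I, ∃ t, t ∉ M ∧ a ∣ t * x) :
    (I.map (algebraMap A (Localization.AtPrime M))).IsPrincipal := by
  refine ⟨algebraMap A _ a, le_antisymm ?_ ?_⟩
  · rw [Ideal.map_le_iff_le_comap]
    intro x hx
    obtain ⟨t, ht, c, hc⟩ := h x hx
    rw [Ideal.mem_comap]
    have hu : IsUnit (algebraMap A (Localization.AtPrime M) t) :=
      IsLocalization.map_units (Localization.AtPrime M) (⟨t, ht⟩ : M.primeCompl)
    refine Submodule.mem_span_singleton.mpr ⟨↑hu.unit⁻¹ * algebraMap A _ c, ?_⟩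
    have := congrArg (algebraMap A (Localization.AtPrime M)) hc
    simp only [map_mul] at this
    rw [smul_eq_mul, mul_assoc, mul_comm (algebraMap A _ c), ← this, ← mul_assoc,
      IsUnit.val_inv_mul, one_mul]
  · rw [Submodule.span_le, Set.singleton_subset_iff]
    exact Ideal.mem_map_of_mem _ ha

lemma fg_common {I M J : Ideal A} [hM : M.IsPrime] {a : A} (hJ : J.FG) (hJI : J ≤ I)
    (h : ∀ x ∈ I, ∃ t, t ∉ M ∧ a ∣ t * x) : ∃ t, t ∉ M ∧ ∀ x ∈ J, a ∣ t * x := by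
  classical
  obtain ⟨S, rfl⟩ := hJ
  have hS : ∀ x ∈ S, x ∈ I := fun x hx => hJI (Submodule.subset_span hx)
  have key : ∀ T : Finset A, (∀ x ∈ T, x ∈ I) → ∃ t, t ∉ M ∧ ∀ x ∈ T, a ∣ t * x := by
    intro T
    induction T using Finset.induction_on with
    | empty => intro _; exact ⟨1, (Ideal.ne_top_iff_one M).mp hM.ne_top, by simp⟩
    | insert b T _ ih =>
      intro hT
      obtain ⟨t, ht, h1⟩ := ih (fun x hx => hT x (Finset.mem_insert_of_mem hx))
      obtain ⟨u, hu, h2⟩ := h b (hT b (Finset.mem_insert_self b T))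
      refine ⟨t * u, fun hh => (hM.mem_or_mem hh).elim ht hu, fun x hx => ?_⟩
      rcases Finset.mem_insert.mp hx with rfl | hx
      · rw [mul_assoc]; exact h2.mul_left t
      · rw [mul_comm t u, mul_assoc]; exact (h1 x hx).mul_left u
  obtain ⟨t, ht, h1⟩ := key S hS
  refine ⟨t, ht, fun x hx => ?_⟩
  induction hx using Submodule.span_induction with
  | mem x hx => exact h1 x hx
  | zero => simp
  | add x y _ _ hx hy => rw [mul_add]; exact dvd_add hx hy
  | smul r x _ hx => rw [smul_eq_mul, mul_left_comm]; exact hx.mul_left r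

/-- division by `a` passes to the v-closure -/
lemma dvd_vOp {J : FractionalIdeal A⁰ K} {J' : Ideal A} (hJ : J ≤ J') {a t x : A} (ha : a ≠ 0)
    (h : ∀ y ∈ J', a ∣ t * y) (hx : algebraMap A K x ∈ vOp A K J) : a ∣ t * x := by
  have ha' : algebraMap A K a ≠ 0 := by
    rwa [Ne, IsFractionRing.to_map_eq_zero_iff]
  have h1 := vOp_mul_mem hx (z := algebraMap A K t / algebraMap A K a) ?_
  · obtain ⟨c, hc⟩ := (FractionalIdeal.mem_one_iff A⁰).mp h1
    refine ⟨c, IsFractionRing.injective A K ?_⟩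
    rw [map_mul, map_mul, hc]
    field_simp
  · intro y hy
    obtain ⟨y, hyy, rfl⟩ := (FractionalIdeal.mem_coeIdeal A⁰).mp (hJ hy)
    obtain ⟨c, hc⟩ := h y hyy
    have := congrArg (algebraMap A K) hc
    rw [map_mul, map_mul] at this
    have h2 : algebraMap A K t / algebraMap A K a * algebraMap A K y = algebraMap A K c := by
      rw [div_mul_eq_mul_div, this, mul_div_cancel_left₀ _ ha']
    rw [h2]
    exact mem_one_alg c

lemma mem_tSet {N : Submodule A K} {x : K} : x ∈ tSet A K N ↔
    ∃ J : FractionalIdeal A⁰ K, (J : Submodule A K) ≤ N ∧ (J : Submodule A K).FG ∧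
      x ∈ vOp A K J := by
  simp only [tSet, Set.mem_iUnion, Set.mem_ofPred_eq, exists_prop, and_assoc]
  rfl

lemma mem_idlSub {I : Ideal A} {x : K} :
    x ∈ idlSub A K I ↔ x ∈ (I : FractionalIdeal A⁰ K) := Iff.rfl

lemma vOp_le_one {J : FractionalIdeal A⁰ K} (hJ : J ≤ 1) : vOp A K J ≤ 1 := by
  intro x hx
  have := vOp_mul_mem hx (z := 1) (fun y hy => by rw [one_mul]; exact hJ hy)
  rwa [mul_one] at this

lemma subset_tSet {I : Ideal A} {x : A} (hx : x ∈ I) :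
    algebraMap A K x ∈ tSet A K (idlSub A K I) := by
  rw [mem_tSet]
  by_cases h0 : x = 0
  · refine ⟨0, ?_, ?_, ?_⟩
    · rw [FractionalIdeal.coe_zero]; exact bot_le
    · rw [FractionalIdeal.coe_zero]; exact Submodule.fg_bot
    · rw [h0, map_zero]; exact FractionalIdeal.zero_mem _
  · have hne : Ideal.span {x} ≠ 0 := by
      intro h; exact h0 (Ideal.span_singleton_eq_bot.mp h)
    refine ⟨(Ideal.span {x} : Ideal A), ?_, ?_, ?_⟩
    · exact (FractionalIdeal.coeIdeal_le_coeIdeal K).mpr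
        ((Ideal.span_singleton_le_iff_mem I).mpr hx)
    · rw [FractionalIdeal.coeIdeal_fg A⁰ (IsFractionRing.injective A K)]
      exact ⟨{x}, by simp⟩
    · exact le_vOp (coe_ne hne) FractionalIdeal.coeIdeal_le_one
        (alg_mem.mpr (Ideal.mem_span_singleton_self x))

/-- a star-locally principal star-ideal is a t-ideal -/
lemma isTIdeal (s : StarOperation A K) (hs : s.IsFiniteType) {I : Ideal A} (h0 : I ≠ 0)
    (hI : IsStarIdeal s I) (hl : StarLocallyPrincipal s I) : IsTIdeal A K I := by
  refine ⟨h0, Set.Subset.antisymm ?_ ?_⟩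
  · intro x hx
    obtain ⟨J, hJI, hJfg, hxJ⟩ := mem_tSet.mp hx
    have hJI : J ≤ (I : FractionalIdeal A⁰ K) := hJI
    have hJ1 : J ≤ 1 := hJI.trans FractionalIdeal.coeIdeal_le_one
    obtain ⟨x, rfl⟩ := (FractionalIdeal.mem_one_iff A⁰).mp (vOp_le_one hJ1 hxJ)
    obtain ⟨J, rfl⟩ := FractionalIdeal.le_one_iff_exists_coeIdeal.mp hJ1
    rw [FractionalIdeal.coeIdeal_le_coeIdeal] at hJI
    rw [FractionalIdeal.coeIdeal_fg A⁰ (IsFractionRing.injective A K)] at hJfg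
    have hQ : I ≤ I.colon {x} := by
      intro y hy
      rw [Submodule.mem_colon_singleton, smul_eq_mul]
      exact I.mul_mem_right _ hy
    have hQ0 : I.colon {x} ≠ 0 := by
      intro h; rw [h] at hQ; exact h0 (le_bot_iff.mp hQ)
    have h1 : s.star ((I.colon {x} : Ideal A) : FractionalIdeal A⁰ K) = 1 := by
      refine star_eq_one s hs hQ0 (fun M hMp hM => ?_)
      obtain ⟨a, haI, ha⟩ := locPrin_elem (hl M hM)
      have ha0 : a ≠ 0 := by
        rintro rfl
        apply h0
        refine (Submodule.eq_bot_iff _).mpr (fun y hy => ?_)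
        obtain ⟨t, ht, hd⟩ := ha y hy
        have ht0 : t ≠ 0 := by rintro rfl; exact ht M.zero_mem
        exact (mul_eq_zero.mp (zero_dvd_iff.mp hd)).resolve_left ht0
      obtain ⟨t, ht, htJ⟩ := fg_common hJfg hJI ha
      refine ⟨t, ?_, ht⟩
      rw [Submodule.mem_colon_singleton, smul_eq_mul]
      exact I.mem_of_dvd (dvd_vOp le_rfl ha0 htJ hxJ) haI
    have h2 := mul_mem_star s (N := (I : FractionalIdeal A⁰ K)) (coe_ne hQ0)
      (z := algebraMap A K x) (x := 1) ?_ ?_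
    · rw [mul_one, hI.2] at h2
      exact h2
    · intro y hy
      obtain ⟨y, hyy, rfl⟩ := (FractionalIdeal.mem_coeIdeal A⁰).mp hy
      rw [← map_mul, alg_mem, mul_comm]
      exact Submodule.mem_colon_singleton.mp hyy
    · rw [h1]; exact FractionalIdeal.one_mem_one A⁰
  · intro x hx
    obtain ⟨x, hxx, rfl⟩ := (FractionalIdeal.mem_coeIdeal A⁰).mp (mem_idlSub.mp hx)
    exact subset_tSet hxx

lemma isTLocallyPrincipal (s : StarOperation A K) (hs : s.IsFiniteType) {I : Ideal A}
    (hl : StarLocallyPrincipal s I) : TLocallyPrincipal' (A := A) (K := K) I := by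
  intro M hMp hM
  have hMs : IsStarIdeal s M := by
    refine isStarIdeal_of_le s hM.2.1.1 (fun x hx => ?_)
    obtain ⟨J, hJ0, hJle, hJfg, hxJ⟩ := hs _ (coe_ne hM.2.1.1) x hx
    have h1 : x ∈ tSet A K (idlSub A K M) := mem_tSet.mpr ⟨J, hJle, hJfg,
      star_le_vOp s hJ0 (hJle.trans FractionalIdeal.coeIdeal_le_one) hxJ⟩
    rw [hM.2.1.2] at h1
    exact h1
  obtain ⟨P, hMP, hP⟩ := exists_starMaximal s hs hM.1 hMs
  have := starMaximal_prime s hP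
  obtain ⟨a, haI, ha⟩ := locPrin_elem (hl P hP)
  refine locPrin_of_elem haI (fun x hx => ?_)
  obtain ⟨t, ht, h⟩ := ha x hx
  exact ⟨t, fun h => ht (hMP h), h⟩

lemma star_mul_inv (s : StarOperation A K) (hs : s.IsFiniteType) {I : Ideal A} (h0 : I ≠ 0)
    (hI : IsTIdeal A K I) (hl : StarLocallyPrincipal s I) (hf : IsTFinite A K I) :
    s.star ((I : FractionalIdeal A⁰ K) * (1 / (I : FractionalIdeal A⁰ K))) = 1 := by
  obtain ⟨-, J, hJ0, hJfg, hJ⟩ := hf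
  rw [hI.2] at hJ
  have hJI : J ≤ I := fun x hx => by
    have := subset_tSet (K := K) hx
    rw [hJ] at this
    exact alg_mem.mp (mem_idlSub.mp this)
  have hne := one_div_ne (coe_ne (K := K) h0) FractionalIdeal.coeIdeal_le_one
  obtain ⟨Q, hQ⟩ := FractionalIdeal.le_one_iff_exists_coeIdeal.mp
    (FractionalIdeal.mul_one_div_le_one (I := (I : FractionalIdeal A⁰ K)))
  have hQ0 : Q ≠ 0 := by
    rintro rfl
    have h3 := frac_mul_ne (coe_ne (K := K) h0) hne
    rw [← hQ] at h3
    exact h3 (FractionalIdeal.coeIdeal_bot)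
  rw [← hQ]
  refine star_eq_one s hs hQ0 (fun M hMp hM => ?_)
  obtain ⟨a, haI, ha⟩ := locPrin_elem (hl M hM)
  have ha0 : a ≠ 0 := by
    rintro rfl
    apply h0
    refine (Submodule.eq_bot_iff _).mpr (fun y hy => ?_)
    obtain ⟨t, ht, hd⟩ := ha y hy
    have ht0 : t ≠ 0 := by rintro rfl; exact ht M.zero_mem
    exact (mul_eq_zero.mp (zero_dvd_iff.mp hd)).resolve_left ht0
  have ha' : algebraMap A K a ≠ 0 := by
    rwa [Ne, IsFractionRing.to_map_eq_zero_iff]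
  obtain ⟨t, ht, htJ⟩ := fg_common hJfg hJI ha
  refine ⟨t, ?_, ht⟩
  rw [← alg_mem (K := K), hQ]
  have h4 : algebraMap A K t / algebraMap A K a ∈ (1 / (I : FractionalIdeal A⁰ K)) := by
    rw [FractionalIdeal.mem_div_iff_of_ne_zero (coe_ne h0)]
    intro y hy
    have hy' : y ∈ tSet A K (idlSub A K J) := by rw [hJ]; exact hy
    obtain ⟨y, hyI, rfl⟩ := (FractionalIdeal.mem_coeIdeal A⁰).mp hy
    obtain ⟨L, hL, -, hyL⟩ := mem_tSet.mp hy'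
    obtain ⟨c, hc⟩ := dvd_vOp (J' := J) hL ha0 htJ hyL
    have := congrArg (algebraMap A K) hc
    rw [map_mul, map_mul] at this
    rw [div_mul_eq_mul_div, this, mul_div_cancel_left₀ _ ha']
    exact mem_one_alg c
  have h5 := FractionalIdeal.mul_mem_mul (alg_mem.mpr haI) h4
  rwa [mul_div_cancel₀ _ ha'] at h5

lemma exists_fg_one {I : Ideal A} {Q : FractionalIdeal A⁰ K} {x : K}
    (hx : x ∈ (I : FractionalIdeal A⁰ K) * Q) :
    ∃ F : Ideal A, F.FG ∧ F ≤ I ∧ x ∈ (F : FractionalIdeal A⁰ K) * Q := by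
  refine FractionalIdeal.mul_induction_on hx ?_ ?_
  · intro i hi j hj
    obtain ⟨i, hii, rfl⟩ := (FractionalIdeal.mem_coeIdeal A⁰).mp hi
    exact ⟨Ideal.span {i}, ⟨{i}, by simp⟩, (Ideal.span_singleton_le_iff_mem I).mpr hii,
      FractionalIdeal.mul_mem_mul (alg_mem.mpr (Ideal.mem_span_singleton_self i)) hj⟩
  · rintro x y ⟨F, hF, hFI, hx⟩ ⟨G, hG, hGI, hy⟩
    refine ⟨F ⊔ G, Submodule.FG.sup hF hG, sup_le hFI hGI, ?_⟩
    have h1 : (F : FractionalIdeal A⁰ K) * Q ≤ ((F ⊔ G : Ideal A) : FractionalIdeal A⁰ K) * Q :=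
      mul_le_mul_left ((FractionalIdeal.coeIdeal_le_coeIdeal K).mpr le_sup_left) Q
    have h2 : (G : FractionalIdeal A⁰ K) * Q ≤ ((F ⊔ G : Ideal A) : FractionalIdeal A⁰ K) * Q :=
      mul_le_mul_left ((FractionalIdeal.coeIdeal_le_coeIdeal K).mpr le_sup_right) Q
    exact Submodule.add_mem _ (h1 hx) (h2 hy)

lemma exists_fg {I : Ideal A} {Q L : FractionalIdeal A⁰ K} (hL : (L : Submodule A K).FG)
    (hle : L ≤ (I : FractionalIdeal A⁰ K) * Q) :
    ∃ F : Ideal A, F.FG ∧ F ≤ I ∧ L ≤ (F : FractionalIdeal A⁰ K) * Q := by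
  classical
  obtain ⟨S, hS⟩ := hL
  have key : ∀ T : Finset K, (∀ x ∈ T, x ∈ (I : FractionalIdeal A⁰ K) * Q) →
      ∃ F : Ideal A, F.FG ∧ F ≤ I ∧ ∀ x ∈ T, x ∈ (F : FractionalIdeal A⁰ K) * Q := by
    intro T
    induction T using Finset.induction_on with
    | empty => intro _; exact ⟨⊥, Submodule.fg_bot, bot_le, by simp⟩
    | insert b T _ ih =>
      intro hT
      obtain ⟨F, hF, hFI, hx⟩ := ih (fun x hx => hT x (Finset.mem_insert_of_mem hx))
      obtain ⟨G, hG, hGI, hy⟩ := exists_fg_one (hT b (Finset.mem_insert_self b T))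
      refine ⟨F ⊔ G, Submodule.FG.sup hF hG, sup_le hFI hGI, fun x hxT => ?_⟩
      have h1 : (F : FractionalIdeal A⁰ K) * Q ≤
          ((F ⊔ G : Ideal A) : FractionalIdeal A⁰ K) * Q :=
        mul_le_mul_left ((FractionalIdeal.coeIdeal_le_coeIdeal K).mpr le_sup_left) Q
      have h2 : (G : FractionalIdeal A⁰ K) * Q ≤
          ((F ⊔ G : Ideal A) : FractionalIdeal A⁰ K) * Q :=
        mul_le_mul_left ((FractionalIdeal.coeIdeal_le_coeIdeal K).mpr le_sup_right) Q
      rcases Finset.mem_insert.mp hxT with rfl | hxT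
      · exact h2 hy
      · exact h1 (hx x hxT)
  obtain ⟨F, hF, hFI, h⟩ := key S (fun x hx => hle (by
    have : x ∈ (L : Submodule A K) := by rw [← hS]; exact Submodule.subset_span hx
    exact this))
  refine ⟨F, hF, hFI, ?_⟩
  rw [← FractionalIdeal.coe_le_coe, ← hS, Submodule.span_le]
  exact h

lemma isStarFinite (s : StarOperation A K) (hs : s.IsFiniteType) {I : Ideal A} (h0 : I ≠ 0)
    (hI : IsStarIdeal s I)
    (h1 : s.star ((I : FractionalIdeal A⁰ K) * (1 / (I : FractionalIdeal A⁰ K))) = 1) :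
    IsStarFinite s I := by
  have hne := one_div_ne (coe_ne (K := K) h0) FractionalIdeal.coeIdeal_le_one
  obtain ⟨L, hL0, hLle, hLfg, hL1⟩ := hs _ (frac_mul_ne (coe_ne (K := K) h0) hne) 1
    (by rw [h1]; exact FractionalIdeal.one_mem_one A⁰)
  obtain ⟨F, hF, hFI, hLF⟩ := exists_fg hLfg hLle
  have hF0 : F ≠ 0 := by
    rintro rfl
    apply hL0
    rw [Ideal.zero_eq_bot, FractionalIdeal.coeIdeal_bot, zero_mul] at hLF
    exact le_antisymm hLF (FractionalIdeal.zero_le _)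
  refine ⟨h0, F, hF0, hF, le_antisymm
    (s.mono _ _ (coe_ne hF0) ((FractionalIdeal.coeIdeal_le_coeIdeal K).mpr hFI)) ?_⟩
  rw [hI.2]
  intro x hx
  have h2 := mul_mem_star s (N := (F : FractionalIdeal A⁰ K)) hL0 (z := x) ?_ hL1
  · rwa [mul_one] at h2
  · intro y hy
    have h3 := FractionalIdeal.mul_mem_mul hx (hLF hy)
    have h4 : (I : FractionalIdeal A⁰ K) * (F * (1 / (I : FractionalIdeal A⁰ K))) ≤ F := by
      calc (I : FractionalIdeal A⁰ K) * (F * (1 / (I : FractionalIdeal A⁰ K)))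
          = (I * (1 / (I : FractionalIdeal A⁰ K))) * F := by ring
        _ ≤ 1 * F := mul_le_mul_left FractionalIdeal.mul_one_div_le_one _
        _ = F := one_mul _
    exact h4 h3

/-- the identity star operation -/
def idStar (A : Type*) [CommRing A] [IsDomain A]
    (K : Type*) [Field K] [Algebra A K] [IsFractionRing A K] : StarOperation A K where
  star I := I
  star_one := rfl
  star_smul _ _ _ _ := rfl
  le_star _ _ := le_rfl
  mono _ _ _ h := h
  star_idem _ _ := rfl

lemma idStar_finiteType : (idStar A K).IsFiniteType := by
  intro I h0 x hx
  have hx : x ∈ I := hx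
  by_cases hx0 : x = 0
  · obtain ⟨y, hy, hy0⟩ : ∃ y ∈ I, y ≠ 0 := by
      by_contra! hcon
      exact h0 (FractionalIdeal.eq_zero_iff.mpr hcon)
    refine ⟨FractionalIdeal.spanSingleton A⁰ y,
      FractionalIdeal.spanSingleton_ne_zero_iff.mpr hy0,
      FractionalIdeal.spanSingleton_le_iff_mem.mpr hy, ?_, ?_⟩
    · rw [FractionalIdeal.coe_spanSingleton]; exact Submodule.fg_span_singleton y
    · rw [hx0]; exact FractionalIdeal.zero_mem _
  · refine ⟨FractionalIdeal.spanSingleton A⁰ x,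
      FractionalIdeal.spanSingleton_ne_zero_iff.mpr hx0,
      FractionalIdeal.spanSingleton_le_iff_mem.mpr hx, ?_,
      FractionalIdeal.mem_spanSingleton_self A⁰ x⟩
    rw [FractionalIdeal.coe_spanSingleton]; exact Submodule.fg_span_singleton x

end StarAux

/-- Let `A` be an integral domain in which every nonzero `t`-locally principal
`t`-ideal is `t`-finite. Then for any finite type star operation `⋆` on `A`, every
nonzero ⋆-locally principal ⋆-ideal of `A` is ⋆-finite. In particular, every nonzero
locally principal ideal of `A` is finitely generated, hence invertible. -/
theorem starFinite_of_starLocallyPrincipal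
    (ht : ∀ I : Ideal A, I ≠ 0 → IsTIdeal A K I → TLocallyPrincipal' (A := A) (K := K) I →
      IsTFinite A K I) :
    (∀ s : StarOperation A K, s.IsFiniteType →
      ∀ I : Ideal A, I ≠ 0 → IsStarIdeal s I → StarLocallyPrincipal s I →
        IsStarFinite s I) ∧
    (∀ I : Ideal A, I ≠ 0 →
      (∀ (M : Ideal A) [M.IsMaximal],
        (I.map (algebraMap A (Localization.AtPrime M))).IsPrincipal) →
      I.FG ∧ (I : FractionalIdeal A⁰ K) * (1 / (I : FractionalIdeal A⁰ K)) = 1) := by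

  refine ⟨fun s hs I h0 hI hl => ?_, fun I h0 hl => ?_⟩
  · have hT := StarAux.isTIdeal s hs h0 hI hl
    exact StarAux.isStarFinite s hs h0 hI (StarAux.star_mul_inv s hs h0 hT hl
      (ht I h0 hT (StarAux.isTLocallyPrincipal s hs hl)))
  · have hs := StarAux.idStar_finiteType (A := A) (K := K)
    have hI : IsStarIdeal (StarAux.idStar A K) I := ⟨h0, rfl⟩
    have hl' : StarLocallyPrincipal (StarAux.idStar A K) I := by
      intro M hMp hM
      have : M.IsMaximal := by
        refine ⟨⟨hM.1, fun J hJ => ?_⟩⟩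
        by_contra hne
        refine hJ.ne' (hM.2.2 J hne ⟨?_, rfl⟩ hJ.le)
        rintro rfl
        exact not_lt_bot hJ
      exact hl M
    have hT := StarAux.isTIdeal _ hs h0 hI hl'
    have h1 := StarAux.star_mul_inv _ hs h0 hT hl'
      (ht I h0 hT (StarAux.isTLocallyPrincipal _ hs hl'))
    obtain ⟨-, J, hJ0, hJ, hJI⟩ := StarAux.isStarFinite _ hs h0 hI h1
    have hJI : (J : FractionalIdeal A⁰ K) = I := hJI
    rw [FractionalIdeal.coeIdeal_inj] at hJI
    exact ⟨hJI ▸ hJ, h1⟩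
end
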